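/- Let A be a bireversible automaton whose automaton group G_A is finite. Then π₁(Δ_A) is virtually a direct product of two free groups: there exist subgroups K ≤ ⟨S⟩ and H ≤ ⟨X⟩ of π₁(Δ_A) such that every element of K commutes with every element of H, K ∩ H = {1}, and the subgroup generated by K ∪ H has finite index in π₁(Δ_A). Moreover π₁(Δ_A) is residually finite. -/

import Mathlib

/-- A Mealy automaton with state set `S` and alphabet `X`:
`λ(s,x) = (o s x, t s x)`. -/
structure Mealy (S X : Type) where
  o : S → X → X
  t : S → X → S

namespace Mealy

variable {S X : Type}

/-- Bireversibility of a Mealy automaton. -/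
def Bireversible (M : Mealy S X) : Prop :=
  (∀ s, Function.Bijective (M.o s)) ∧
  (∀ x, Function.Bijective (fun s => M.t s x)) ∧
  Function.Bijective (fun p : S × X => (M.o p.1 p.2, M.t p.1 p.2))

/-- The action of a state on words over the alphabet. -/
def actWord (M : Mealy S X) : S → List X → List X
  | _, [] => []
  | s, x :: w => M.o s x :: M.actWord (M.t s x) w

/-- The dual action of a letter on words over the states. -/
def dualActWord (M : Mealy S X) : X → List S → List S
  | _, [] => []
  | x, s :: w => M.t s x :: M.dualActWord (M.o s x) w

/-- The relators `s x (t s x)⁻¹ (o s x)⁻¹` of the square-complex group. -/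
def rels (M : Mealy S X) : Set (FreeGroup (S ⊕ X)) :=
  ⋃ (s : S) (x : X),
    {FreeGroup.of (Sum.inl s) * FreeGroup.of (Sum.inr x) *
      (FreeGroup.of (Sum.inl (M.t s x)))⁻¹ * (FreeGroup.of (Sum.inr (M.o s x)))⁻¹}

/-- The fundamental group `π₁(Δ_A)` of the square complex of the automaton. -/
abbrev Pi1 (M : Mealy S X) := PresentedGroup M.rels

/-- The image of a state in `π₁(Δ_A)`. -/
def genS (M : Mealy S X) (s : S) : M.Pi1 := PresentedGroup.of (Sum.inl s)

/-- The image of a letter in `π₁(Δ_A)`. -/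
def genX (M : Mealy S X) (x : X) : M.Pi1 := PresentedGroup.of (Sum.inr x)

/-- The subgroup `⟨S⟩` of `π₁(Δ_A)`. -/
def subS (M : Mealy S X) : Subgroup M.Pi1 := Subgroup.closure (Set.range M.genS)

/-- The subgroup `⟨X⟩` of `π₁(Δ_A)`. -/
def subX (M : Mealy S X) : Subgroup M.Pi1 := Subgroup.closure (Set.range M.genX)

/-- The automaton group `G_A`: the subgroup of `Perm (List X)` generated by the
permutations `σ_s` defined by the states. -/
def autGroup (M : Mealy S X) : Subgroup (Equiv.Perm (List X)) :=
  Subgroup.closure {σ : Equiv.Perm (List X) | ∃ s, ⇑σ = M.actWord s}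

/-- The dual automaton group `G_{∂A}`. -/
def dualAutGroup (M : Mealy S X) : Subgroup (Equiv.Perm (List S)) :=
  Subgroup.closure {τ : Equiv.Perm (List S) | ∃ x, ⇑τ = M.dualActWord x}

end Mealy

namespace FreeGroup

variable {α : Type*} [DecidableEq α]

theorem finite_norm_le [Finite α] (n : ℕ) : Finite {v : FreeGroup α // v.norm ≤ n} := by
  have := (List.finite_length_le (α × Bool) n).to_subtype
  exact Finite.of_injective
    (fun v => (⟨v.1.toWord, v.2⟩ : {l : List (α × Bool) | l.length ≤ n}))
    fun v w h => Subtype.ext (toWord_injective (congrArg Subtype.val h))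

/-- Left multiplication by a generator, as a partial bijection of the ball of radius `n`. -/
def ballPartialMul (n : ℕ) (a : α) :
    {v : {v : FreeGroup α // v.norm ≤ n} // (of a * v.1).norm ≤ n} ≃
      {v : {v : FreeGroup α // v.norm ≤ n} // ((of a)⁻¹ * v.1).norm ≤ n} where
  toFun v := ⟨⟨of a * v.1.1, v.2⟩, by simpa using v.1.2⟩
  invFun v := ⟨⟨(of a)⁻¹ * v.1.1, v.2⟩, by simpa using v.1.2⟩
  left_inv v := by ext; simp
  right_inv v := by ext; simp

theorem exists_perm_ball_lift_mk_apply_one [Finite α] (n : ℕ) :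
    ∃ f : α → Equiv.Perm {v : FreeGroup α // v.norm ≤ n},
      ∀ L : List (α × Bool), L.length ≤ n →
        (lift f (mk L) ⟨1, norm_one.trans_le n.zero_le⟩).1 = mk L := by
  classical
  have := finite_norm_le (α := α) n
  have := Fintype.ofFinite {v : FreeGroup α // v.norm ≤ n}
  have key (a : α) (v : {v : FreeGroup α // v.norm ≤ n}) (h : (of a * v.1).norm ≤ n) :
      (ballPartialMul n a).extendSubtype v = ⟨of a * v.1, h⟩ :=
    (ballPartialMul n a).extendSubtype_apply_of_mem v h
  refine ⟨fun a => (ballPartialMul n a).extendSubtype, fun L hL => ?_⟩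
  induction L with
  | nil => simp [← one_eq_mk]
  | cons p L ih =>
    obtain ⟨a, b⟩ := p
    have hlen : L.length ≤ n := (Nat.le_succ _).trans hL
    have hn : (mk ((a, b) :: L)).norm ≤ n := norm_mk_le.trans hL
    have hv := ih hlen
    have hsplit : (mk ((a, b) :: L) : FreeGroup α) = mk [(a, b)] * mk L := by simp [mul_mk]
    rw [hsplit] at hn ⊢
    rw [_root_.map_mul, Equiv.Perm.mul_apply]
    generalize hw : lift (fun a => (ballPartialMul n a).extendSubtype) (mk L)
      ⟨1, norm_one.trans_le n.zero_le⟩ = w at hv ⊢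
    rw [← hv] at hn ⊢
    cases b with
    | true =>
      change (lift (fun a => (ballPartialMul n a).extendSubtype) (of a) w).1 = of a * w.1
      rw [lift_apply_of, key a w hn]
    | false =>
      have hinv : (mk [(a, false)] : FreeGroup α) = (of a)⁻¹ := by simp [of, inv_mk, invRev]
      rw [hinv] at hn ⊢
      rw [_root_.map_inv, lift_apply_of]
      have h1 : (ballPartialMul n a).extendSubtype ⟨(of a)⁻¹ * w.1, hn⟩ = w := by
        rw [key a _ (by simpa using w.2)]
        ext
        simp
      rw [Equiv.Perm.inv_eq_iff_eq.mpr h1.symm]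

instance residuallyFinite {α : Type*} [Finite α] : Group.ResiduallyFinite (FreeGroup α) := by
  classical
  rw [Group.residuallyFinite_iff_exists_finiteIndex]
  intro g hg
  obtain ⟨f, hf⟩ := exists_perm_ball_lift_mk_apply_one (α := α) g.norm
  have := finite_norm_le (α := α) g.norm
  refine ⟨(lift f).ker, Subgroup.finiteIndex_ker _, fun hk => hg ?_⟩
  have h := hf g.toWord le_rfl
  rw [mk_toWord, MonoidHom.mem_ker.mp hk] at h
  exact h.symm

end FreeGroup

namespace Group.ResiduallyFinite

theorem of_injective {G H : Type*} [Group G] [Group H] [ResiduallyFinite H] {f : G →* H}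
    (hf : Function.Injective f) : ResiduallyFinite G := by
  rw [residuallyFinite_iff_exists_finiteIndex]
  intro g hg
  obtain ⟨N, hN⟩ := exists_finiteIndexNormalSubgroup_notMem (f g) ((map_ne_one_iff f hf).mpr hg)
  exact ⟨(N.comap f).toSubgroup, inferInstance, hN⟩

end Group.ResiduallyFinite

namespace Subgroup

variable {G : Type*} [Group G]

theorem finiteIndex_of_relIndex_ne_zero_of_mul {A B L : Subgroup G} [L.Normal]
    (hA : L.relIndex A ≠ 0) (hB : L.relIndex B ≠ 0)
    (hmul : ∀ g, ∃ b ∈ B, ∃ a ∈ A, g = b * a) : L.FiniteIndex := by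
  rw [← QuotientGroup.ker_mk' L, relIndex_ker] at hA hB
  have := Nat.finite_of_card_ne_zero hA
  have := Nat.finite_of_card_ne_zero hB
  rw [finiteIndex_iff_finite_quotient]
  refine Finite.of_surjective
    (fun p : B.map (QuotientGroup.mk' L) × A.map (QuotientGroup.mk' L) => p.1.1 * p.2.1)
    fun q => ?_
  obtain ⟨g, rfl⟩ := QuotientGroup.mk'_surjective L q
  obtain ⟨b, hb, a, ha, rfl⟩ := hmul g
  exact ⟨⟨⟨_, mem_map_of_mem _ hb⟩, ⟨_, mem_map_of_mem _ ha⟩⟩, (map_mul _ _ _).symm⟩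

theorem finiteIndex_sup_of_relIndex_ne_zero {N K H : Subgroup G} [H.Normal]
    (hN : N.relIndex K ≠ 0) (hKH : (K ⊔ H).FiniteIndex) : (N ⊔ H).FiniteIndex := by
  set f := QuotientGroup.mk' H
  have hsurj : Function.Surjective f := QuotientGroup.mk'_surjective H
  have hsup (J : Subgroup G) : J ⊔ H = (J.map f).comap f := by
    rw [comap_map_eq, QuotientGroup.ker_mk']
  rw [finiteIndex_iff, hsup, index_comap_of_surjective _ hsurj] at hKH ⊢
  have h : (N.map f).relIndex (K.map f) ≠ 0 := by
    rw [← relIndex_comap]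
    exact mt (relIndex_eq_zero_of_le_left (le_comap_map f N)) hN
  rw [← relIndex_top_right] at hKH ⊢
  exact relIndex_ne_zero_trans h hKH

theorem exists_relIndex_ne_zero_notMem {A : Subgroup G} [Group.ResiduallyFinite A] {a : G}
    (ha : a ∈ A) (ha1 : a ≠ 1) : ∃ N : Subgroup G, N.relIndex A ≠ 0 ∧ a ∉ N := by
  obtain ⟨N, hN⟩ := Group.exists_finiteIndexNormalSubgroup_notMem (⟨a, ha⟩ : A)
    (fun h => ha1 (congrArg Subtype.val h))
  refine ⟨N.toSubgroup.map A.subtype, ?_, ?_⟩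
  · rw [relIndex, subgroupOf, comap_map_eq_self_of_injective A.subtype_injective]
    exact FiniteIndex.index_ne_zero
  · rintro ⟨b, hb, hba⟩
    rw [show b = ⟨a, ha⟩ from Subtype.ext hba] at hb
    exact hN hb

theorem exists_normal_finiteIndex_mul_notMem {A K H : Subgroup G} [Group.ResiduallyFinite A]
    [H.Normal] (hKA : K ≤ A) (hdisj : K ⊓ H = ⊥) (hKH : (K ⊔ H).FiniteIndex)
    {k h : G} (hk : k ∈ K) (hk1 : k ≠ 1) (hh : h ∈ H) :
    ∃ N : Subgroup G, N.Normal ∧ N.FiniteIndex ∧ k * h ∉ N := by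
  obtain ⟨N, hN, hkN⟩ := exists_relIndex_ne_zero_notMem (hKA hk) hk1
  have hfi : ((N ⊓ K) ⊔ H).FiniteIndex := by
    refine finiteIndex_sup_of_relIndex_ne_zero (K := K) ?_ hKH
    rw [inf_relIndex_right]
    exact mt (relIndex_eq_zero_of_le_right hKA) hN
  refine ⟨((N ⊓ K) ⊔ H).normalCore, inferInstance, inferInstance, fun hmem => hkN ?_⟩
  obtain ⟨a, ⟨haN, haK⟩, b, hb, hab⟩ := mem_sup_of_normal_right.mp (normalCore_le _ hmem)
  have hq : a⁻¹ * k = b * h⁻¹ := by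
    rw [inv_mul_eq_iff_eq_mul, ← mul_assoc, hab, mul_inv_cancel_right]
  have hbot : a⁻¹ * k ∈ K ⊓ H :=
    ⟨K.mul_mem (K.inv_mem haK) hk, hq ▸ H.mul_mem hb (H.inv_mem hh)⟩
  rw [hdisj, mem_bot, inv_mul_eq_one] at hbot
  exact hbot ▸ haN

theorem virtually_product_and_residuallyFinite {A B K H : Subgroup G}
    [Group.ResiduallyFinite A] [Group.ResiduallyFinite B] [K.Normal] [H.Normal]
    (hAB : A ⊓ B = ⊥) (hmul : ∀ g, ∃ b ∈ B, ∃ a ∈ A, g = b * a)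
    (hKA : K ≤ A) (hHB : H ≤ B) (hK : K.relIndex A ≠ 0) (hH : H.relIndex B ≠ 0) :
    ((∀ k ∈ K, ∀ h ∈ H, Commute k h) ∧ K ⊓ H = ⊥ ∧ (K ⊔ H).FiniteIndex) ∧
      ∀ g : G, g ≠ 1 → ∃ N : Subgroup G, N.Normal ∧ N.FiniteIndex ∧ g ∉ N := by
  have hdisj : K ⊓ H = ⊥ := eq_bot_iff.mpr (hAB ▸ inf_le_inf hKA hHB)
  have hcomm (k) (hk : k ∈ K) (h) (hh : h ∈ H) : Commute k h :=
    commute_of_normal_of_disjoint K H inferInstance inferInstance (disjoint_iff.mpr hdisj)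
      k h hk hh
  have hfi : (K ⊔ H).FiniteIndex :=
    finiteIndex_of_relIndex_ne_zero_of_mul
      (mt (relIndex_eq_zero_of_le_left le_sup_left) hK)
      (mt (relIndex_eq_zero_of_le_left le_sup_right) hH) hmul
  refine ⟨⟨hcomm, hdisj, hfi⟩, fun g hg => ?_⟩
  by_cases hgL : g ∈ K ⊔ H
  · obtain ⟨k, hk, h, hh, rfl⟩ := mem_sup_of_normal_right.mp hgL
    by_cases hk1 : k = 1
    · rw [(hcomm k hk h hh).eq]
      refine exists_normal_finiteIndex_mul_notMem hHB (inf_comm K H ▸ hdisj)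
        (sup_comm K H ▸ hfi) hh (fun hh1 => hg ?_) hk
      rw [hk1, hh1, one_mul]
    · exact exists_normal_finiteIndex_mul_notMem hKA hdisj hfi hk hk1 hh
  · exact ⟨K ⊔ H, inferInstance, hfi, hgL⟩

end Subgroup
theorem Subgroup.closure_induction_of_finite {G : Type*} [Group G] {s : Set G}
    (hs : (Submonoid.closure s : Set G).Finite) {p : G → Prop} (mem : ∀ x ∈ s, p x) (one : p 1)
    (mul : ∀ x y, p x → p y → p (x * y)) {x : G} (hx : x ∈ Subgroup.closure s) : p x := by
  have hfin (y : G) (hy : y ∈ Submonoid.closure s) : IsOfFinOrder y :=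
    finite_powers.mp (hs.subset (Submonoid.powers_le.mpr hy))
  have hle : Subgroup.closure s ≤
      { Submonoid.closure s with
        inv_mem' := fun {y} hy => by
          have hpow : y⁻¹ ∈ Submonoid.powers y :=
            (hfin y hy).mem_powers_iff_mem_zpowers.mpr
              ((Subgroup.zpowers y).inv_mem (Subgroup.mem_zpowers y))
          exact Submonoid.powers_le.mpr hy hpow } :=
    (Subgroup.closure_le _).mpr Submonoid.subset_closure
  have hx' : x ∈ Submonoid.closure s := hle hx
  clear hx
  induction hx' using Submonoid.closure_induction with
  | mem x h => exact mem x h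
  | one => exact one
  | mul x y _ _ h1 h2 => exact mul x y h1 h2

namespace Mealy

section GroupAutomaton

variable {G X : Type} (A : Mealy G X) (hA : ∀ x, Function.Bijective (fun g => A.t g x))

/-- A letter acting on pairs (accumulated output, state). -/
noncomputable def stepPerm (x : X) : Equiv.Perm (FreeGroup X × G) :=
  Equiv.ofBijective (fun p => (p.1 * FreeGroup.of (A.o p.2 x), A.t p.2 x)) <| by
    constructor
    · rintro ⟨u, g⟩ ⟨v, h⟩ heq
      obtain ⟨h1, h2⟩ := Prod.mk.inj heq
      obtain rfl : g = h := (hA x).1 h2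
      exact Prod.ext (mul_right_cancel h1) rfl
    · rintro ⟨u, g⟩
      obtain ⟨h, rfl⟩ := (hA x).2 g
      exact ⟨(u * (FreeGroup.of (A.o h x))⁻¹, h), by simp⟩

@[simp]
theorem stepPerm_apply (x : X) (p : FreeGroup X × G) :
    A.stepPerm hA x p = (p.1 * FreeGroup.of (A.o p.2 x), A.t p.2 x) := rfl

/-- The right action of the free group on pairs (accumulated output, state). -/
noncomputable def run : FreeGroup X →* (Equiv.Perm (FreeGroup X × G))ᵐᵒᵖ :=
  FreeGroup.lift fun x => MulOpposite.op (A.stepPerm hA x)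

/-- The output of a state reading an element of the free group. -/
noncomputable def act (g : G) (w : FreeGroup X) : FreeGroup X := ((A.run hA w).unop (1, g)).1

/-- The state reached after reading an element of the free group. -/
noncomputable def res (g : G) (w : FreeGroup X) : G := ((A.run hA w).unop (1, g)).2

theorem run_apply (w u : FreeGroup X) (g : G) :
    (A.run hA w).unop (u, g) = (u * A.act hA g w, A.res hA g w) := by
  suffices h : ∀ p : FreeGroup X × G, (A.run hA w).unop (u * p.1, p.2) =
      (u * ((A.run hA w).unop p).1, ((A.run hA w).unop p).2) by
    simpa [act, res] using h (1, g)
  induction w using FreeGroup.induction_on with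
  | C1 => simp
  | of x => intro p; simp [run, mul_assoc]
  | inv_of x ih =>
    intro p
    rw [map_inv, MulOpposite.unop_inv, Equiv.Perm.inv_eq_iff_eq, ih]
    simp
  | mul v w hv hw => intro p; simp [hv, hw]

@[simp]
theorem act_one (g : G) : A.act hA g 1 = 1 := by simp [act]

@[simp]
theorem res_one (g : G) : A.res hA g 1 = g := by simp [res]

@[simp]
theorem act_of (g : G) (x : X) : A.act hA g (FreeGroup.of x) = FreeGroup.of (A.o g x) := by
  simp [act, run]

@[simp]
theorem res_of (g : G) (x : X) : A.res hA g (FreeGroup.of x) = A.t g x := by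
  simp [res, run]

theorem act_mul (g : G) (v w : FreeGroup X) :
    A.act hA g (v * w) = A.act hA g v * A.act hA (A.res hA g v) w := by
  rw [act, map_mul, MulOpposite.unop_mul, Equiv.Perm.mul_apply, run_apply, run_apply, one_mul]

theorem res_mul (g : G) (v w : FreeGroup X) :
    A.res hA g (v * w) = A.res hA (A.res hA g v) w := by
  rw [res, map_mul, MulOpposite.unop_mul, Equiv.Perm.mul_apply, run_apply, run_apply]

theorem act_inv_res (g : G) (w : FreeGroup X) :
    A.act hA (A.res hA g w) w⁻¹ = (A.act hA g w)⁻¹ := by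
  refine eq_inv_of_mul_eq_one_right ?_
  rw [← act_mul, mul_inv_cancel, act_one]

theorem res_inv_res (g : G) (w : FreeGroup X) : A.res hA (A.res hA g w) w⁻¹ = g := by
  rw [← res_mul, mul_inv_cancel, res_one]

theorem res_res_inv (g : G) (w : FreeGroup X) : A.res hA (A.res hA g w⁻¹) w = g := by
  rw [← res_mul, inv_mul_cancel, res_one]

variable [Group G]

/-- The states form a group, and products of states act by composition. -/
structure IsGroupAutomaton : Prop where
  bijective_t : ∀ x, Function.Bijective (fun g => A.t g x)
  o_one : ∀ x, A.o 1 x = x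
  t_one : ∀ x, A.t 1 x = 1
  o_mul : ∀ g h x, A.o (g * h) x = A.o g (A.o h x)
  t_mul : ∀ g h x, A.t (g * h) x = A.t g (A.o h x) * A.t h x

namespace IsGroupAutomaton

variable {A} (hG : A.IsGroupAutomaton)

include hG in
theorem act_res_one (w : FreeGroup X) :
    A.act hG.bijective_t 1 w = w ∧ A.res hG.bijective_t 1 w = 1 := by
  induction w using FreeGroup.induction_on with
  | C1 => simp
  | of x => simp [hG.o_one, hG.t_one]
  | inv_of x ih =>
    have h1 := A.act_inv_res hG.bijective_t 1 (FreeGroup.of x)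
    have h2 := A.res_inv_res hG.bijective_t 1 (FreeGroup.of x)
    rw [ih.2] at h1 h2
    rw [h1, ih.1]
    exact ⟨rfl, h2⟩
  | mul v w hv hw => simp [act_mul, res_mul, hv, hw]

include hG in
theorem act_res_mul (g h : G) (w : FreeGroup X) :
    A.act hG.bijective_t (g * h) w = A.act hG.bijective_t g (A.act hG.bijective_t h w) ∧
      A.res hG.bijective_t (g * h) w =
        A.res hG.bijective_t g (A.act hG.bijective_t h w) * A.res hG.bijective_t h w := by
  induction w using FreeGroup.induction_on generalizing g h with
  | C1 => simp
  | of x => simp [hG.o_mul, hG.t_mul]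
  | inv_of x ih =>
    set w := FreeGroup.of x
    obtain ⟨h, rfl⟩ : ∃ h', A.res hG.bijective_t h' w = h := ⟨_, A.res_res_inv hG.bijective_t h w⟩
    obtain ⟨g, rfl⟩ : ∃ g', A.res hG.bijective_t g' (A.act hG.bijective_t h w) = g :=
      ⟨_, A.res_res_inv hG.bijective_t g _⟩
    obtain ⟨h1, h2⟩ := ih g h
    rw [← h2]
    simp only [act_inv_res, res_inv_res, h1, and_self]
  | mul v w hv hw => simp [act_mul, res_mul, hv, hw]

/-- The action of the group of states on the free group over the alphabet. -/
noncomputable def actHom : G →* Equiv.Perm (FreeGroup X) :=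
  letI : MulAction G (FreeGroup X) :=
    { smul := A.act hG.bijective_t
      one_smul := fun w => (hG.act_res_one w).1
      mul_smul := fun g h w => (hG.act_res_mul g h w).1 }
  MulAction.toPermHom G (FreeGroup X)

theorem actHom_apply (g : G) (w : FreeGroup X) :
    hG.actHom g w = A.act hG.bijective_t g w := rfl

theorem actHom_apply_one (g : G) : hG.actHom g 1 = 1 := by simp [actHom_apply]

theorem actHom_of_mul (g : G) (x : X) (w : FreeGroup X) :
    hG.actHom g (FreeGroup.of x * w) = FreeGroup.of (A.o g x) * hG.actHom (A.t g x) w := by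
  simp [actHom_apply, act_mul]

end IsGroupAutomaton

end GroupAutomaton

end Mealy

namespace Mealy

variable {S X : Type} {M : Mealy S X}

theorem genS_mul_genX (s : S) (x : X) :
    M.genS s * M.genX x = M.genX (M.o s x) * M.genS (M.t s x) := by
  have h : FreeGroup.of (Sum.inl s) * FreeGroup.of (Sum.inr x) *
      (FreeGroup.of (Sum.inl (M.t s x)))⁻¹ * (FreeGroup.of (Sum.inr (M.o s x)))⁻¹ ∈ M.rels := by
    simp only [rels, Set.mem_iUnion]
    exact ⟨s, x, rfl⟩
  have h1 := PresentedGroup.one_of_mem h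
  rw [map_mul, map_mul, map_mul, map_inv, map_inv, mul_inv_eq_one, mul_inv_eq_iff_eq_mul] at h1
  exact h1

theorem genX_mem_subX (x : X) : M.genX x ∈ M.subX := Subgroup.subset_closure ⟨x, rfl⟩

theorem genS_mem_subS (s : S) : M.genS s ∈ M.subS := Subgroup.subset_closure ⟨s, rfl⟩

/-- The homomorphism out of `π₁(Δ_A)` determined by images of the states and letters. -/
def piLift {P : Type*} [Group P] (f : S → P) (g : X → P)
    (h : ∀ s x, f s * g x = g (M.o s x) * f (M.t s x)) : M.Pi1 →* P :=
  PresentedGroup.toGroup (f := Sum.elim f g) <| by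
    intro r hr
    simp only [rels, Set.mem_iUnion, Set.mem_singleton_iff] at hr
    obtain ⟨s, x, rfl⟩ := hr
    simp [h]

@[simp]
theorem piLift_genS {P : Type*} [Group P] (f : S → P) (g : X → P)
    (h : ∀ s x, f s * g x = g (M.o s x) * f (M.t s x)) (s : S) :
    piLift f g h (M.genS s) = f s :=
  PresentedGroup.toGroup.of _

@[simp]
theorem piLift_genX {P : Type*} [Group P] (f : S → P) (g : X → P)
    (h : ∀ s x, f s * g x = g (M.o s x) * f (M.t s x)) (x : X) :
    piLift f g h (M.genX x) = g x :=
  PresentedGroup.toGroup.of _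

theorem piHom_ext {P : Type*} [Group P] {f g : M.Pi1 →* P}
    (hS : ∀ s, f (M.genS s) = g (M.genS s)) (hX : ∀ x, f (M.genX x) = g (M.genX x)) : f = g :=
  PresentedGroup.ext (Sum.rec hS hX)

theorem Bireversible.exists_mul_eq_mul (hb : M.Bireversible) {u : M.Pi1} (hu : u ∈ M.subX) (s : S) :
    (∃ v ∈ M.subX, ∃ t, M.genS s * u = v * M.genS t) ∧
      ∃ v ∈ M.subX, ∃ t, (M.genS s)⁻¹ * u = v * (M.genS t)⁻¹ := by
  induction hu using Subgroup.closure_induction'' generalizing s with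
  | mem u hu =>
    obtain ⟨x, rfl⟩ := hu
    refine ⟨⟨_, genX_mem_subX _, _, genS_mul_genX s x⟩, ?_⟩
    obtain ⟨y, rfl⟩ := (hb.1 s).2 x
    refine ⟨_, genX_mem_subX y, M.t s y, ?_⟩
    rw [inv_mul_eq_iff_eq_mul, ← mul_assoc, genS_mul_genX, mul_inv_cancel_right]
  | inv_mem u hu =>
    obtain ⟨x, rfl⟩ := hu
    constructor
    · obtain ⟨t, rfl⟩ := (hb.2.1 x).2 s
      refine ⟨_, inv_mem (genX_mem_subX (M.o t x)), t, ?_⟩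
      rw [mul_inv_eq_iff_eq_mul, mul_assoc, genS_mul_genX, inv_mul_cancel_left]
    · obtain ⟨⟨t, y⟩, hty⟩ := hb.2.2.2 (x, s)
      obtain ⟨rfl, rfl⟩ := Prod.mk.inj hty
      refine ⟨_, inv_mem (genX_mem_subX y), t, ?_⟩
      rw [← mul_inv_rev, ← mul_inv_rev, genS_mul_genX]
  | one => exact ⟨⟨1, one_mem _, s, by simp⟩, 1, one_mem _, s, by simp⟩
  | mul u v _ _ hu hv =>
    constructor
    · obtain ⟨u', hu', t, h1⟩ := (hu s).1
      obtain ⟨v', hv', r, h2⟩ := (hv t).1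
      exact ⟨u' * v', mul_mem hu' hv', r, by rw [← mul_assoc, h1, mul_assoc, h2, mul_assoc]⟩
    · obtain ⟨u', hu', t, h1⟩ := (hu s).2
      obtain ⟨v', hv', r, h2⟩ := (hv t).2
      exact ⟨u' * v', mul_mem hu' hv', r, by rw [← mul_assoc, h1, mul_assoc, h2, mul_assoc]⟩

theorem Bireversible.exists_eq_mul (hb : M.Bireversible) (g : M.Pi1) :
    ∃ u ∈ M.subX, ∃ v ∈ M.subS, g = u * v := by
  have hg : g ∈ Subgroup.closure (Set.range M.genS ∪ Set.range M.genX) := by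
    refine PresentedGroup.generated_by M.rels _ (fun j => Subgroup.subset_closure ?_) g
    cases j with
    | inl s => exact Or.inl ⟨s, rfl⟩
    | inr x => exact Or.inr ⟨x, rfl⟩
  induction hg using Subgroup.closure_induction_left with
  | one => exact ⟨1, one_mem _, 1, one_mem _, by simp⟩
  | mul_left a ha g _ ih =>
    obtain ⟨u, hu, v, hv, rfl⟩ := ih
    rcases ha with ⟨s, rfl⟩ | ⟨x, rfl⟩
    · obtain ⟨w, hw, t, h⟩ := (hb.exists_mul_eq_mul hu s).1
      exact ⟨w, hw, _, mul_mem (genS_mem_subS t) hv, by rw [← mul_assoc, h, mul_assoc]⟩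
    · exact ⟨_, mul_mem (genX_mem_subX x) hu, v, hv, (mul_assoc _ _ _).symm⟩
  | inv_mul_cancel a ha g _ ih =>
    obtain ⟨u, hu, v, hv, rfl⟩ := ih
    rcases ha with ⟨s, rfl⟩ | ⟨x, rfl⟩
    · obtain ⟨w, hw, t, h⟩ := (hb.exists_mul_eq_mul hu s).2
      exact ⟨w, hw, _, mul_mem (inv_mem (genS_mem_subS t)) hv, by rw [← mul_assoc, h, mul_assoc]⟩
    · exact ⟨_, mul_mem (inv_mem (genX_mem_subX x)) hu, v, hv, (mul_assoc _ _ _).symm⟩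

theorem range_lift_genX : (FreeGroup.lift M.genX).range = M.subX := FreeGroup.range_lift_eq_closure

section Action

variable {G : Type} [Group G] {A : Mealy G X} (hG : A.IsGroupAutomaton) {σ : S → G}
  (ho : ∀ s x, A.o (σ s) x = M.o s x) (ht : ∀ s x, A.t (σ s) x = σ (M.t s x))

/-- The action of `π₁(Δ_A)` on the free group over the alphabet: letters act by left
multiplication and states act through a group automaton. -/
noncomputable def piAction : M.Pi1 →* Equiv.Perm (FreeGroup X) :=
  piLift (fun s => hG.actHom (σ s)) (fun x => Equiv.mulLeft (FreeGroup.of x)) fun s x => by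
    ext1 w
    simp [hG.actHom_of_mul, ho, ht]

theorem piAction_lift_genX (w v : FreeGroup X) :
    piAction hG ho ht (FreeGroup.lift M.genX w) v = w * v := by
  have h : (piAction hG ho ht).comp (FreeGroup.lift M.genX) =
      MulAction.toPermHom (FreeGroup X) (FreeGroup X) := by
    ext x w
    simp [piAction]
  exact DFunLike.congr_fun (DFunLike.congr_fun h w) v

theorem map_piAction_subS_le : M.subS.map (piAction hG ho ht) ≤ hG.actHom.range := by
  rw [Subgroup.map_le_iff_le_comap, subS, Subgroup.closure_le]
  rintro _ ⟨s, rfl⟩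
  exact ⟨σ s, by simp [piAction]⟩

theorem piAction_apply_one_of_mem_subS {g : M.Pi1} (hg : g ∈ M.subS) :
    piAction hG ho ht g 1 = 1 := by
  obtain ⟨a, ha⟩ := map_piAction_subS_le hG ho ht (Subgroup.mem_map_of_mem _ hg)
  rw [← ha, hG.actHom_apply_one]

include hG ho ht in
theorem lift_genX_injective_of_isGroupAutomaton :
    Function.Injective (FreeGroup.lift M.genX) := by
  intro v w h
  have h1 := congrArg (fun g => piAction hG ho ht g 1) h
  simpa [piAction_lift_genX] using h1

include hG ho ht in
theorem subS_inf_subX_of_isGroupAutomaton : M.subS ⊓ M.subX = ⊥ := by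
  rw [eq_bot_iff]
  rintro g ⟨hS, hX⟩
  rw [SetLike.mem_coe, ← range_lift_genX] at hX
  obtain ⟨w, rfl⟩ := hX
  have h := piAction_apply_one_of_mem_subS hG ho ht hS
  rw [piAction_lift_genX, mul_one] at h
  simp [h]

include hG ho ht in
theorem exists_normal_le_subS_of_isGroupAutomaton [Finite G] (hb : M.Bireversible) :
    ∃ K : Subgroup M.Pi1, K.Normal ∧ K ≤ M.subS ∧ K.relIndex M.subS ≠ 0 := by
  refine ⟨(piAction hG ho ht).ker, inferInstance, fun g hg => ?_, ?_⟩
  · obtain ⟨u, hu, v, hv, rfl⟩ := hb.exists_eq_mul g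
    rw [← range_lift_genX] at hu
    obtain ⟨w, rfl⟩ := hu
    have h := DFunLike.congr_fun (MonoidHom.mem_ker.mp hg) 1
    rw [map_mul, Equiv.Perm.mul_apply, piAction_apply_one_of_mem_subS hG ho ht hv,
      piAction_lift_genX, mul_one, Equiv.Perm.one_apply] at h
    simpa [h] using hv
  · rw [Subgroup.relIndex_ker]
    have : Finite hG.actHom.range := Set.finite_range hG.actHom
    have : Finite (M.subS.map (piAction hG ho ht)) :=
      Finite.Set.subset (hG.actHom.range : Set _) (map_piAction_subS_le hG ho ht)
    exact Nat.card_pos.ne'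

end Action

end Mealy

namespace Mealy

variable {S X : Type} {M : Mealy S X}

theorem Bireversible.bijective_actWord (hb : M.Bireversible) (s : S) :
    Function.Bijective (M.actWord s) := by
  constructor
  · intro v
    induction v generalizing s with
    | nil => intro w h; cases w <;> simp_all [actWord]
    | cons x v ih =>
      intro w h
      cases w with
      | nil => simp [actWord] at h
      | cons y w =>
        obtain ⟨h1, h2⟩ := List.cons.inj h
        obtain rfl := (hb.1 s).1 h1
        rw [ih _ h2]
  · intro w
    induction w generalizing s with
    | nil => exact ⟨[], rfl⟩
    | cons y w ih =>
      obtain ⟨x, rfl⟩ := (hb.1 s).2 y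
      obtain ⟨v, rfl⟩ := ih (M.t s x)
      exact ⟨x :: v, rfl⟩

/-- The permutation of words defined by a state. -/
noncomputable def Bireversible.statePerm (hb : M.Bireversible) (s : S) : Equiv.Perm (List X) :=
  Equiv.ofBijective (M.actWord s) (hb.bijective_actWord s)

theorem Bireversible.statePerm_mem_autGroup (hb : M.Bireversible) (s : S) :
    hb.statePerm s ∈ M.autGroup :=
  Subgroup.subset_closure ⟨s, rfl⟩

theorem autGroup_induction (hfin : Finite M.autGroup) {p : Equiv.Perm (List X) → Prop}
    (mem : ∀ (σ : Equiv.Perm (List X)) (s : S), ⇑σ = M.actWord s → p σ)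
    (one : p 1) (mul : ∀ g h, p g → p h → p (g * h))
    {g : Equiv.Perm (List X)} (hg : g ∈ M.autGroup) : p g :=
  Subgroup.closure_induction_of_finite
    ((Set.toFinite (M.autGroup : Set _)).subset (Subgroup.le_closure_toSubmonoid _))
    (fun σ ⟨s, hs⟩ => mem σ s hs) one mul hg

theorem Bireversible.exists_section (hb : M.Bireversible) (hfin : Finite M.autGroup)
    {g : Equiv.Perm (List X)} (hg : g ∈ M.autGroup) :
    ∀ x, ∃ y, ∃ h ∈ M.autGroup, ∀ w, g (x :: w) = y :: h w := by
  refine autGroup_induction (p := fun g => ∀ x, ∃ y, ∃ h ∈ M.autGroup, ∀ w, g (x :: w) = y :: h w)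
    hfin (fun σ s hs x => ?_) (fun x => ?_) (fun g h hg hh x => ?_) hg
  · exact ⟨M.o s x, _, hb.statePerm_mem_autGroup (M.t s x), fun w => by rw [hs]; rfl⟩
  · exact ⟨x, 1, one_mem _, fun w => rfl⟩
  · obtain ⟨y, h', hh', h1⟩ := hh x
    obtain ⟨z, g', hg', h2⟩ := hg y
    exact ⟨z, g' * h', mul_mem hg' hh', fun w => by simp [h1, h2]⟩

theorem Bireversible.exists_section_eq (hb : M.Bireversible) (hfin : Finite M.autGroup)
    {h : Equiv.Perm (List X)} (hh : h ∈ M.autGroup) :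
    ∀ x, ∃ g ∈ M.autGroup, ∃ y, ∀ w, g (x :: w) = y :: h w := by
  refine autGroup_induction (p := fun h => ∀ x, ∃ g ∈ M.autGroup, ∃ y, ∀ w, g (x :: w) = y :: h w)
    hfin (fun σ s hs x => ?_) (fun x => ?_) (fun g h hg hh x => ?_) hh
  · obtain ⟨t, rfl⟩ := (hb.2.1 x).2 s
    exact ⟨_, hb.statePerm_mem_autGroup t, M.o t x, fun w => by rw [hs]; rfl⟩
  · exact ⟨1, one_mem _, x, fun w => rfl⟩
  · obtain ⟨h', hh', y, h1⟩ := hh x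
    obtain ⟨g', hg', z, h2⟩ := hg y
    exact ⟨g' * h', mul_mem hg' hh', z, fun w => by simp [h1, h2]⟩

theorem Bireversible.exists_isGroupAutomaton (hb : M.Bireversible) (hfin : Finite M.autGroup) :
    ∃ (A : Mealy M.autGroup X) (σ : S → M.autGroup), A.IsGroupAutomaton ∧
      (∀ s x, A.o (σ s) x = M.o s x) ∧ ∀ s x, A.t (σ s) x = σ (M.t s x) := by
  have hsec (g : M.autGroup) (x : X) : ∃ y, ∃ h : M.autGroup, ∀ w, g.1 (x :: w) = y :: h.1 w := by
    obtain ⟨y, h, hh, heq⟩ := hb.exists_section hfin g.2 x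
    exact ⟨y, ⟨h, hh⟩, heq⟩
  choose o t hot using hsec
  have huniq (g : M.autGroup) (x y : X) (h : M.autGroup)
      (heq : ∀ w, g.1 (x :: w) = y :: h.1 w) : o g x = y ∧ t g x = h := by
    have hw (w : List X) := List.cons.inj ((hot g x w).symm.trans (heq w))
    exact ⟨(hw []).1, Subtype.ext (Equiv.ext fun w => (hw w).2)⟩
  have hone (x : X) := huniq 1 x x 1 fun w => rfl
  have hmul (g h : M.autGroup) (x : X) :=
    huniq (g * h) x (o g (o h x)) (t g (o h x) * t h x) fun w => by simp [hot]
  have hstate (s : S) (x : X) :=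
    huniq ⟨_, hb.statePerm_mem_autGroup s⟩ x (M.o s x) ⟨_, hb.statePerm_mem_autGroup (M.t s x)⟩
      fun w => rfl
  refine ⟨⟨o, t⟩, fun s => ⟨_, hb.statePerm_mem_autGroup s⟩, ⟨fun x => ?_, fun x => (hone x).1,
    fun x => (hone x).2, fun g h x => (hmul g h x).1, fun g h x => (hmul g h x).2⟩,
    fun s x => (hstate s x).1, fun s x => (hstate s x).2⟩
  have hsurj : Function.Surjective (fun g => t g x) := fun h => by
    obtain ⟨g, hg, y, heq⟩ := hb.exists_section_eq hfin h.2 x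
    exact ⟨⟨g, hg⟩, (huniq _ x y h heq).2⟩
  exact ⟨Finite.injective_iff_surjective.mpr hsurj, hsurj⟩

section Dual

/-- The dual automaton, exchanging states and letters. -/
def dual (M : Mealy S X) : Mealy X S := ⟨fun x s => M.t s x, fun x s => M.o s x⟩

theorem Bireversible.dual (hb : M.Bireversible) : M.dual.Bireversible :=
  ⟨hb.2.1, hb.1, (Prod.swap_bijective.comp hb.2.2).comp Prod.swap_bijective⟩

/-- The composite action of the letters of a word on words over the states. -/
def dualWordAct (M : Mealy S X) : List X → List S → List S
  | [], u => u
  | x :: w, u => M.dualWordAct w (M.dual.actWord x u)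

/-- The state reached after reading a word. -/
def resWord (M : Mealy S X) : S → List X → S
  | s, [] => s
  | s, x :: w => M.resWord (M.t s x) w

theorem dualWordAct_append (v w : List X) (u : List S) :
    M.dualWordAct (v ++ w) u = M.dualWordAct w (M.dualWordAct v u) := by
  induction v generalizing u with
  | nil => rfl
  | cons x v ih => exact ih _

theorem dualWordAct_nil_right (w : List X) : M.dualWordAct w [] = [] := by
  induction w with
  | nil => rfl
  | cons x w ih => exact ih

theorem dualWordAct_cons (w : List X) (s : S) (u : List S) :
    M.dualWordAct w (s :: u) = M.resWord s w :: M.dualWordAct (M.actWord s w) u := by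
  induction w generalizing s u with
  | nil => rfl
  | cons x w ih => exact ih _ _

theorem Bireversible.dualWordAct_eq (hb : M.Bireversible) {v w : List X}
    (h : ∀ (g : M.autGroup) s, M.resWord s (g.1 v) = M.resWord s (g.1 w)) (u : List S) :
    M.dualWordAct v u = M.dualWordAct w u := by
  induction u generalizing v w with
  | nil => rw [dualWordAct_nil_right, dualWordAct_nil_right]
  | cons s u ih =>
    rw [dualWordAct_cons, dualWordAct_cons]
    refine congrArg₂ _ (h 1 s) (ih fun g r => ?_)
    exact h (g * ⟨_, hb.statePerm_mem_autGroup s⟩) r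

theorem Bireversible.finite_range_dualWordAct [Finite S] (hb : M.Bireversible)
    (hfin : Finite M.autGroup) : (Set.range M.dualWordAct).Finite := by
  have hf : Function.FactorsThrough M.dualWordAct
      (fun w (g : M.autGroup) s => M.resWord s (g.1 w)) := fun v w h =>
    funext (hb.dualWordAct_eq fun g s => congrFun (congrFun h g) s)
  obtain ⟨e, he⟩ := (Function.factorsThrough_iff _).mp hf
  rw [he]
  exact (Set.finite_range e).subset (Set.range_comp_subset_range _ _)

theorem Bireversible.finite_autGroup_dual [Finite S] (hb : M.Bireversible)
    (hfin : Finite M.autGroup) : Finite M.dual.autGroup := by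
  let N : Submonoid (Equiv.Perm (List S)) :=
    { carrier := {τ | ∃ w, ⇑τ = M.dualWordAct w}
      one_mem' := ⟨[], rfl⟩
      mul_mem' := by
        rintro τ ρ ⟨v, hv⟩ ⟨w, hw⟩
        exact ⟨w ++ v, funext fun u => by simp [hv, hw, dualWordAct_append]⟩ }
  have hN : (N : Set (Equiv.Perm (List S))).Finite :=
    Set.Finite.of_finite_image (f := fun τ : Equiv.Perm (List S) => ⇑τ)
      ((hb.finite_range_dualWordAct hfin).subset
        (by rintro _ ⟨τ, ⟨w, hw⟩, rfl⟩; exact ⟨w, hw.symm⟩))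
      DFunLike.coe_injective.injOn
  have hle : Submonoid.closure {τ : Equiv.Perm (List S) | ∃ x, ⇑τ = M.dual.actWord x} ≤ N :=
    Submonoid.closure_le.mpr fun τ ⟨x, hx⟩ => ⟨[x], hx⟩
  refine (hN.subset fun τ hτ => ?_).to_subtype
  exact Subgroup.closure_induction_of_finite (hN.subset hle)
    (fun τ hτ => hle (Submonoid.subset_closure hτ)) N.one_mem (fun _ _ => N.mul_mem) hτ

/-- Inverting the generators identifies `π₁(Δ_A)` with the group of the dual automaton. -/
def piDualHom (M : Mealy S X) : M.Pi1 →* M.dual.Pi1 :=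
  piLift (fun s => (M.dual.genX s)⁻¹) (fun x => (M.dual.genS x)⁻¹) fun s x => by
    rw [← mul_inv_rev, ← mul_inv_rev, genS_mul_genX]
    rfl

theorem piDualHom_genS (s : S) : M.piDualHom (M.genS s) = (M.dual.genX s)⁻¹ := by
  simp [piDualHom]

theorem piDualHom_genX (x : X) : M.piDualHom (M.genX x) = (M.dual.genS x)⁻¹ := by
  simp [piDualHom]

/-- `π₁(Δ_A)` is isomorphic to the group of the dual automaton. -/
def piDualEquiv (M : Mealy S X) : M.Pi1 ≃* M.dual.Pi1 :=
  MonoidHom.toMulEquiv M.piDualHom M.dual.piDualHom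
    (piHom_ext (fun s => by simp [piDualHom]; rfl) (fun x => by simp [piDualHom]; rfl))
    (piHom_ext (fun s => by simp [piDualHom]; rfl) (fun x => by simp [piDualHom]; rfl))

theorem map_piDualEquiv_subS : M.subS.map M.piDualEquiv.toMonoidHom = M.dual.subX := by
  have h : M.piDualEquiv.toMonoidHom '' Set.range M.genS = (Set.range M.dual.genX)⁻¹ := by
    rw [← Set.range_comp, Set.inv_range]
    exact congrArg _ (funext fun s => piDualHom_genS s)
  rw [subS, MonoidHom.map_closure, h, Subgroup.closure_inv, subX]

theorem map_piDualEquiv_subX : M.subX.map M.piDualEquiv.toMonoidHom = M.dual.subS := by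
  have h : M.piDualEquiv.toMonoidHom '' Set.range M.genX = (Set.range M.dual.genS)⁻¹ := by
    rw [← Set.range_comp, Set.inv_range]
    exact congrArg _ (funext fun x => piDualHom_genX x)
  rw [subX, MonoidHom.map_closure, h, Subgroup.closure_inv, subS]

end Dual

theorem Bireversible.residuallyFinite_subX [Finite X] (hb : M.Bireversible)
    (hfin : Finite M.autGroup) : Group.ResiduallyFinite M.subX := by
  obtain ⟨A, σ, hG, ho, ht⟩ := hb.exists_isGroupAutomaton hfin
  let e := MonoidHom.ofInjective (lift_genX_injective_of_isGroupAutomaton hG ho ht)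
  rw [← range_lift_genX]
  exact Group.ResiduallyFinite.of_injective (f := e.symm.toMonoidHom) e.symm.injective

theorem Bireversible.subS_inf_subX (hb : M.Bireversible) (hfin : Finite M.autGroup) :
    M.subS ⊓ M.subX = ⊥ := by
  obtain ⟨A, σ, hG, ho, ht⟩ := hb.exists_isGroupAutomaton hfin
  exact subS_inf_subX_of_isGroupAutomaton hG ho ht

theorem Bireversible.exists_normal_le_subS (hb : M.Bireversible) (hfin : Finite M.autGroup) :
    ∃ K : Subgroup M.Pi1, K.Normal ∧ K ≤ M.subS ∧ K.relIndex M.subS ≠ 0 := by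
  obtain ⟨A, σ, hG, ho, ht⟩ := hb.exists_isGroupAutomaton hfin
  exact exists_normal_le_subS_of_isGroupAutomaton hG ho ht hb

theorem Bireversible.residuallyFinite_subS [Finite S] (hb : M.Bireversible)
    (hfin : Finite M.autGroup) : Group.ResiduallyFinite M.subS := by
  have := hb.dual.residuallyFinite_subX (hb.finite_autGroup_dual hfin)
  rw [← map_piDualEquiv_subS] at this
  let e := M.subS.equivMapOfInjective M.piDualEquiv.toMonoidHom M.piDualEquiv.injective
  exact Group.ResiduallyFinite.of_injective (f := e.toMonoidHom) e.injective

theorem Bireversible.exists_normal_le_subX [Finite S] (hb : M.Bireversible)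
    (hfin : Finite M.autGroup) :
    ∃ H : Subgroup M.Pi1, H.Normal ∧ H ≤ M.subX ∧ H.relIndex M.subX ≠ 0 := by
  obtain ⟨K, hK, hle, hidx⟩ := hb.dual.exists_normal_le_subS (hb.finite_autGroup_dual hfin)
  rw [← map_piDualEquiv_subX] at hle hidx
  refine ⟨K.comap M.piDualEquiv.toMonoidHom, inferInstance, fun g hg => ?_, ?_⟩
  · exact (Subgroup.mem_map_iff_mem M.piDualEquiv.injective).mp (hle hg)
  · rwa [Subgroup.relIndex_comap]

end Mealy

open Mealy in
/-- If `G_A` is finite then `π₁(Δ_A)` is virtually a direct product of two free groups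
(one inside `⟨S⟩`, one inside `⟨X⟩`) and is residually finite. -/
theorem finite_autGroup_virtually_product_residuallyFinite {S X : Type}
    [Finite S] [Finite X] [Nonempty S] [Nonempty X]
    (M : Mealy S X) (hb : M.Bireversible) (hfin : Finite M.autGroup) :
    (∃ K H : Subgroup M.Pi1, K ≤ M.subS ∧ H ≤ M.subX ∧
      (∀ k ∈ K, ∀ h ∈ H, Commute k h) ∧ K ⊓ H = ⊥ ∧ (K ⊔ H).FiniteIndex) ∧
    (∀ γ : M.Pi1, γ ≠ 1 →
      ∃ N : Subgroup M.Pi1, N.Normal ∧ N.FiniteIndex ∧ γ ∉ N) := by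
  obtain ⟨K, hK, hKS, hKi⟩ := hb.exists_normal_le_subS hfin
  obtain ⟨H, hH, hHX, hHi⟩ := hb.exists_normal_le_subX hfin
  have := hb.residuallyFinite_subS hfin
  have := hb.residuallyFinite_subX hfin
  obtain ⟨hprod, hrf⟩ := Subgroup.virtually_product_and_residuallyFinite
    (hb.subS_inf_subX hfin) hb.exists_eq_mul hKS hHX hKi hHi
  exact ⟨⟨K, H, hKS, hHX, hprod⟩, hrf⟩
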